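/- arXiv:2207.05840 — 2 statements merged into one kernel-verified Lean document; each statement's English description precedes it below -/
import Mathlib

section
/- Let r ≥ 1 be an integer and let G be a 3-graph in which every vertex v satisfies deg v ≤ r^2/(3e), where deg v is the number of edges of G containing v and e is Euler's number. Then G admits a proper coloring with r colors. -/
/-- A 3-graph: a finite vertex set `Fin n` together with a family of 3-element edges. -/
structure ThreeGraph where
  n : ℕ
  edges : Finset (Finset (Fin n))
  card_eq : ∀ e ∈ edges, e.card = 3

namespace ThreeGraph

/-- `G` contains a (not necessarily induced) copy of `H`. -/
def ContainsCopy (G H : ThreeGraph) : Prop :=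
  ∃ f : Fin H.n ↪ Fin G.n, ∀ e ∈ H.edges, e.image f ∈ G.edges

/-- `G` is `H`-free: it contains no subgraph isomorphic to `H`. -/
def Free (G H : ThreeGraph) : Prop := ¬ G.ContainsCopy H

/-- `G` admits a proper coloring with `r` colors: no edge is monochromatic. -/
def Colorable (G : ThreeGraph) (r : ℕ) : Prop :=
  ∃ c : Fin G.n → Fin r, ∀ e ∈ G.edges, ∃ u ∈ e, ∃ v ∈ e, c u ≠ c v

/-- `S` is an independent set in `G`: it contains no edge of `G`. -/
def IndepSet (G : ThreeGraph) (S : Finset (Fin G.n)) : Prop :=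
  ∀ e ∈ G.edges, ¬ e ⊆ S

/-- The degree of a vertex: the number of edges containing it. -/
def degree (G : ThreeGraph) (v : Fin G.n) : ℕ :=
  (G.edges.filter (fun e => v ∈ e)).card

end ThreeGraph

/-- Every 3-graph on `N` vertices contains a copy of `H` or an independent set of `t` vertices. -/
def RamseyProp (H : ThreeGraph) (t N : ℕ) : Prop :=
  ∀ G : ThreeGraph, G.n = N →
    G.ContainsCopy H ∨ ∃ S : Finset (Fin G.n), G.IndepSet S ∧ t ≤ S.card

/-- The Ramsey number `R(H, K_t)`: the least `N` such that every 3-graph on `N` vertices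
contains a copy of `H` or an independent set of `t` vertices. -/
noncomputable def ramsey (H : ThreeGraph) (t : ℕ) : ℕ :=
  sInf {N | RamseyProp H t N}

namespace ThreeGraph

/-- The vertex colorings with `r` colors for which no edge contained in `S` is monochromatic. -/
def properOn (G : ThreeGraph) (r : ℕ) (S : Finset (Fin G.n)) : Finset (Fin G.n → Fin r) :=
  Finset.univ.filter fun c => ∀ e ∈ G.edges, e ⊆ S → ∃ u ∈ e, ∃ v ∈ e, c u ≠ c v

theorem mem_properOn {G : ThreeGraph} {r : ℕ} {S : Finset (Fin G.n)} {c : Fin G.n → Fin r} :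
    c ∈ G.properOn r S ↔ ∀ e ∈ G.edges, e ⊆ S → ∃ u ∈ e, ∃ v ∈ e, c u ≠ c v := by
  simp [properOn]

/-- Recoloring two vertices of a monochromatic triple arbitrarily is injective, which bounds the
number of colorings proper on `S` in which the triple is monochromatic. -/
theorem sq_mul_card_mono_le (G : ThreeGraph) (r : ℕ) {S : Finset (Fin G.n)} {u v w : Fin G.n}
    (hv : v ∉ S) (huv : u ≠ v) (hwu : w ≠ u) (hwv : w ≠ v) :
    r ^ 2 * ((G.properOn r S).filter fun c => c u = c w ∧ c v = c w).card ≤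
      (G.properOn r (S.erase u)).card := by
  have hcard : r ^ 2 * ((G.properOn r S).filter fun c => c u = c w ∧ c v = c w).card =
      ((Finset.univ : Finset (Fin r × Fin r)) ×ˢ
        (G.properOn r S).filter fun c => c u = c w ∧ c v = c w).card := by
    simp [Finset.card_product, sq]
  rw [hcard]
  refine Finset.card_le_card_of_injOn
    (fun p => Function.update (Function.update p.2 u p.1.1) v p.1.2) ?_ ?_
  · rintro ⟨⟨a, b⟩, c⟩ hc
    simp only [Finset.coe_product, Finset.coe_univ, Finset.coe_filter, Set.mem_prod, Set.mem_univ,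
      true_and, Set.mem_ofPred_eq] at hc
    refine mem_properOn.2 fun e he heS => ?_
    obtain ⟨x, hx, y, hy, hxy⟩ :=
      mem_properOn.1 hc.1 e he (heS.trans (Finset.erase_subset _ _))
    have hne : ∀ z ∈ e, z ≠ u ∧ z ≠ v := fun z hz =>
      ⟨Finset.ne_of_mem_erase (heS hz),
        fun h => hv (h ▸ Finset.mem_of_mem_erase (heS hz))⟩
    refine ⟨x, hx, y, hy, ?_⟩
    simpa [(hne x hx).1, (hne x hx).2, (hne y hy).1, (hne y hy).2] using hxy
  · rintro ⟨⟨a, b⟩, c⟩ hc ⟨⟨a', b'⟩, c'⟩ hc' h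
    simp only [Finset.coe_product, Finset.coe_univ, Finset.coe_filter, Set.mem_prod, Set.mem_univ,
      true_and, Set.mem_ofPred_eq] at hc hc' h
    have hw : c w = c' w := by simpa [hwu, hwv] using congrFun h w
    have ha : a = a' := by simpa [huv] using congrFun h u
    have hb : b = b' := by simpa using congrFun h v
    have hcc : c = c' := by
      funext x
      by_cases hxu : x = u
      · rw [hxu, hc.2.1, hc'.2.1, hw]
      by_cases hxv : x = v
      · rw [hxv, hc.2.2, hc'.2.2, hw]
      simpa [hxu, hxv] using congrFun h x
    rw [ha, hb, hcc]

/-- If all degrees are at most `r ^ 2 / 4`, then requiring properness at one more vertex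
at most halves the number of colorings. -/
theorem card_properOn_le_two_mul (G : ThreeGraph) (r : ℕ) (hr : 1 ≤ r)
    (hdeg : ∀ v, 4 * G.degree v ≤ r ^ 2) (S : Finset (Fin G.n)) :
    ∀ v ∉ S, (G.properOn r S).card ≤ 2 * (G.properOn r (insert v S)).card := by
  induction S using Finset.strongInduction with
  | H S ih =>
  intro v hv
  let E := G.edges.filter fun e => v ∈ e
  let mono (e : Finset (Fin G.n)) :=
    (G.properOn r S).filter fun c => e ⊆ insert v S ∧ ∀ x ∈ e, ∀ y ∈ e, c x = c y
  have hmono : ∀ e ∈ E, r ^ 2 * (mono e).card ≤ 2 * (G.properOn r S).card := by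
    intro e he
    obtain ⟨heG, hve⟩ := Finset.mem_filter.1 he
    by_cases heS : e ⊆ insert v S
    · have h2 : (e.erase v).card = 2 := by
        rw [Finset.card_erase_of_mem hve, G.card_eq e heG]
      obtain ⟨u, w, huw, huwe⟩ := Finset.card_eq_two.1 h2
      obtain ⟨huv, hue⟩ : u ≠ v ∧ u ∈ e := Finset.mem_erase.1 (by simp [huwe])
      obtain ⟨hwv, hwe⟩ : w ≠ v ∧ w ∈ e := Finset.mem_erase.1 (by simp [huwe])
      have huS : u ∈ S := (Finset.mem_insert.1 (heS hue)).resolve_left huv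
      have hsub : mono e ⊆ (G.properOn r S).filter fun c => c u = c w ∧ c v = c w :=
        Finset.monotone_filter_right _ fun c _ hc =>
          ⟨hc.2 u hue w hwe, hc.2 v hve w hwe⟩
      calc r ^ 2 * (mono e).card
          ≤ r ^ 2 * ((G.properOn r S).filter fun c => c u = c w ∧ c v = c w).card :=
            Nat.mul_le_mul_left _ (Finset.card_le_card hsub)
        _ ≤ (G.properOn r (S.erase u)).card := G.sq_mul_card_mono_le r hv huv huw.symm hwv
        _ ≤ 2 * (G.properOn r (insert u (S.erase u))).card :=
            ih _ (Finset.erase_ssubset huS) u (Finset.notMem_erase u S)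
        _ = 2 * (G.properOn r S).card := by rw [Finset.insert_erase huS]
    · simp [mono, heS]
  have hcover : G.properOn r S ⊆ G.properOn r (insert v S) ∪ E.biUnion mono := by
    intro c hc
    by_cases hcv : c ∈ G.properOn r (insert v S)
    · exact Finset.mem_union_left _ hcv
    refine Finset.mem_union_right _ ?_
    rw [mem_properOn] at hcv
    push Not at hcv
    obtain ⟨e, heG, heS, hce⟩ := hcv
    have hve : v ∈ e := by
      by_contra hve
      obtain ⟨x, hx, y, hy, hxy⟩ :=
        mem_properOn.1 hc e heG ((Finset.subset_insert_iff_of_notMem hve).1 heS)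
      exact hxy (hce x hx y hy)
    exact Finset.mem_biUnion.2
      ⟨e, Finset.mem_filter.2 ⟨heG, hve⟩, Finset.mem_filter.2 ⟨hc, heS, hce⟩⟩
  have hcount : (G.properOn r S).card ≤
      (G.properOn r (insert v S)).card + ∑ e ∈ E, (mono e).card :=
    (Finset.card_le_card hcover).trans <| (Finset.card_union_le _ _).trans <|
      Nat.add_le_add_left Finset.card_biUnion_le _
  have hsum : r ^ 2 * ∑ e ∈ E, (mono e).card ≤ G.degree v * (2 * (G.properOn r S).card) := by
    rw [Finset.mul_sum]
    exact Finset.sum_le_card_nsmul _ _ _ hmono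
  have hhalf : 2 * ∑ e ∈ E, (mono e).card ≤ (G.properOn r S).card := by
    refine Nat.le_of_mul_le_mul_left ?_ (pow_pos hr 2)
    nlinarith [Nat.mul_le_mul_right (G.properOn r S).card (hdeg v)]
  omega

theorem colorable_of_four_mul_degree_le (G : ThreeGraph) (r : ℕ) (hr : 1 ≤ r)
    (hdeg : ∀ v, 4 * G.degree v ≤ r ^ 2) : G.Colorable r := by
  have hpos : ∀ S : Finset (Fin G.n), 0 < (G.properOn r S).card := by
    intro S
    induction S using Finset.induction_on with
    | empty =>
      refine Finset.card_pos.2 ⟨fun _ => ⟨0, hr⟩, mem_properOn.2 fun e he heS => ?_⟩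
      have := G.card_eq e he
      simp [Finset.subset_empty.1 heS] at this
    | insert v S hv ih =>
      have := G.card_properOn_le_two_mul r hr hdeg S v hv
      omega
  obtain ⟨c, hc⟩ := Finset.card_pos.1 (hpos Finset.univ)
  exact ⟨c, fun e he => mem_properOn.1 hc e he (Finset.subset_univ e)⟩

end ThreeGraph

/-- If `r ≥ 1` and every vertex of a 3-graph `G` has degree at most
`r²/(3e)`, then `G` admits a proper coloring with `r` colors. -/
theorem colorable_of_small_degree
    (r : ℕ) (hr : 1 ≤ r) (G : ThreeGraph)
    (hdeg : ∀ v : Fin G.n, (G.degree v : ℝ) ≤ (r : ℝ) ^ 2 / (3 * Real.exp 1)) :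
    G.Colorable r := by
  refine G.colorable_of_four_mul_degree_le r hr fun v => ?_
  have he : 2 ≤ Real.exp 1 := by linarith [Real.add_one_le_exp (1 : ℝ)]
  have h := (le_div_iff₀ (by positivity)).1 (hdeg v)
  have hd : (0 : ℝ) ≤ G.degree v := Nat.cast_nonneg _
  have : (4 : ℝ) * G.degree v ≤ (r : ℝ) ^ 2 := by nlinarith
  exact_mod_cast this
end

section
/- Let r ≥ 1 be an integer, let G be a 3-graph, and let V_small = {v ∈ V(G) : deg v ≤ r^2/(12e)}, where deg v is the degree of v in G and e is Euler's number. Then the induced subgraph G[V_small] admits a proper coloring with ⌈r/2⌉ colors. -/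
/-- `G` restricted to the vertex set `S` admits a proper coloring with `r` colors:
there is an `r`-coloring of the vertices such that no edge of `G` lying inside `S` is
monochromatic (this is exactly `r`-colorability of the induced subgraph `G[S]`). -/
def ThreeGraph.ColorableOn (G : ThreeGraph) (S : Set (Fin G.n)) (r : ℕ) : Prop :=
  ∃ c : Fin G.n → Fin r, ∀ e ∈ G.edges, (↑e : Set (Fin G.n)) ⊆ S →
    ∃ u ∈ e, ∃ v ∈ e, c u ≠ c v

section ProperColorings

variable {α κ : Type*} [Fintype α] [DecidableEq α] [Fintype κ] [DecidableEq κ]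

/-- The colorings of the whole vertex set for which no edge contained in `S` is monochromatic. -/
def properColorings (κ : Type*) [Fintype κ] [DecidableEq κ] (E : Finset (Finset α))
    (S : Finset α) : Finset (α → κ) :=
  Finset.univ.filter fun c => ∀ e ∈ E, e ⊆ S → ∃ u ∈ e, ∃ w ∈ e, c u ≠ c w

theorem mem_properColorings {E : Finset (Finset α)} {S : Finset α} {c : α → κ} :
    c ∈ properColorings κ E S ↔ ∀ e ∈ E, e ⊆ S → ∃ u ∈ e, ∃ w ∈ e, c u ≠ c w := by
  simp [properColorings]

/-- Colorings giving `v`, `a`, `b` a common color can be recolored arbitrarily at `v` and `a`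
without affecting the edges inside `S.erase a`. -/
theorem card_sq_mul_card_filter_le (E : Finset (Finset α)) {S : Finset α} {v a b : α}
    (hv : v ∉ S) (hva : v ≠ a) (hbv : b ≠ v) (hba : b ≠ a) :
    Fintype.card κ ^ 2 *
        ((properColorings κ E S).filter fun c => c v = c b ∧ c a = c b).card ≤
      (properColorings κ E (S.erase a)).card := by
  set T := (properColorings κ E S).filter fun c => c v = c b ∧ c a = c b
  have hcard : ((Finset.univ : Finset (κ × κ)) ×ˢ T).card = Fintype.card κ ^ 2 * T.card := by
    rw [Finset.card_product, Finset.card_univ, Fintype.card_prod, sq]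
  rw [← hcard]
  refine Finset.card_le_card_of_injOn
    (fun p => Function.update (Function.update p.2 v p.1.1) a p.1.2) ?_ ?_
  · rintro ⟨⟨i, j⟩, c⟩ hp
    have hc : c ∈ properColorings κ E S := by
      have := (Finset.mem_product.1 hp).2
      exact (Finset.mem_filter.1 this).1
    refine mem_properColorings.2 fun e he heS => ?_
    obtain ⟨u, hu, w, hw, huw⟩ :=
      mem_properColorings.1 hc e he (heS.trans (Finset.erase_subset _ _))
    have key : ∀ x ∈ e, Function.update (Function.update c v i) a j x = c x := by
      intro x hx
      obtain ⟨hxa, hxS⟩ := Finset.mem_erase.1 (heS hx)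
      rw [Function.update_of_ne hxa, Function.update_of_ne (ne_of_mem_of_not_mem hxS hv)]
    exact ⟨u, hu, w, hw, by simpa only [key u hu, key w hw] using huw⟩
  · rintro ⟨⟨i, j⟩, c⟩ hp ⟨⟨i', j'⟩, c'⟩ hp' h
    obtain ⟨hcv, hca⟩ := (Finset.mem_filter.1 (Finset.mem_product.1 hp).2).2
    obtain ⟨hcv', hca'⟩ := (Finset.mem_filter.1 (Finset.mem_product.1 hp').2).2
    dsimp only at h hcv hca hcv' hca'
    have hj : j = j' := by simpa using congrFun h a
    have hi : i = i' := by simpa [Function.update_of_ne hva] using congrFun h v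
    have hrest : ∀ x, x ≠ v → x ≠ a → c x = c' x := fun x hxv hxa => by
      simpa [Function.update_of_ne hxa, Function.update_of_ne hxv] using congrFun h x
    have hb := hrest b hbv hba
    have hcc : c = c' := by
      funext x
      by_cases hxv : x = v
      · rw [hxv, hcv, hcv', hb]
      by_cases hxa : x = a
      · rw [hxa, hca, hca', hb]
      exact hrest x hxv hxa
    rw [hi, hj, hcc]

/-- A coloring proper on `S` but not on `insert v S` has a monochromatic edge through `v`. -/
theorem card_properColorings_le_add_sum (E : Finset (Finset α)) (S : Finset α) (v : α) :
    (properColorings κ E S).card ≤ (properColorings κ E (insert v S)).card +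
      ∑ e ∈ E.filter (fun e => v ∈ e ∧ e ⊆ insert v S),
        ((properColorings κ E S).filter fun c => ∀ u ∈ e, ∀ w ∈ e, c u = c w).card := by
  refine le_trans (Finset.card_le_card ?_) ((Finset.card_union_le _ _).trans
    (Nat.add_le_add_left Finset.card_biUnion_le _))
  intro c hc
  by_cases h : c ∈ properColorings κ E (insert v S)
  · exact Finset.mem_union_left _ h
  refine Finset.mem_union_right _ ?_
  rw [mem_properColorings] at h
  push Not at h
  obtain ⟨e, he, heS, hmono⟩ := h
  have hve : v ∈ e := by
    by_contra hve
    obtain ⟨u, hu, w, hw, huw⟩ :=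
      mem_properColorings.1 hc e he ((Finset.subset_insert_iff_of_notMem hve).1 heS)
    exact huw (hmono u hu w hw)
  exact Finset.mem_biUnion.2
    ⟨e, Finset.mem_filter.2 ⟨he, hve, heS⟩, Finset.mem_filter.2 ⟨hc, hmono⟩⟩

/-- If `v` and the vertices of `S` have degree at most `k² / 4`, where `k` is the number of colors,
then adding `v` to `S` keeps at least half of the proper colorings. -/
theorem card_properColorings_le_two_mul_insert [Nonempty κ] {E : Finset (Finset α)}
    (hE : ∀ e ∈ E, e.card = 3) (S : Finset α) {v : α} (hv : v ∉ S)
    (hdeg : ∀ x ∈ insert v S, 4 * (E.filter (x ∈ ·)).card ≤ Fintype.card κ ^ 2) :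
    (properColorings κ E S).card ≤ 2 * (properColorings κ E (insert v S)).card := by
  induction S using Finset.strongInduction generalizing v with
  | H S ih =>
    set N := (properColorings κ E S).card
    set k := Fintype.card κ
    have hterm : ∀ e ∈ E.filter (fun e => v ∈ e ∧ e ⊆ insert v S),
        k ^ 2 * ((properColorings κ E S).filter
          fun c => ∀ u ∈ e, ∀ w ∈ e, c u = c w).card ≤ 2 * N := by
      intro e he
      obtain ⟨heE, hve, heS⟩ := Finset.mem_filter.1 he
      have h2 : (e.erase v).card = 2 := by rw [Finset.card_erase_of_mem hve, hE e heE]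
      obtain ⟨a, b, hab, heq⟩ := Finset.card_eq_two.1 h2
      have ha : a ∈ e.erase v := by simp [heq]
      have hb : b ∈ e.erase v := by simp [heq]
      obtain ⟨hav, hae⟩ := Finset.mem_erase.1 ha
      obtain ⟨hbv, hbe⟩ := Finset.mem_erase.1 hb
      have haS : a ∈ S := Finset.mem_of_mem_insert_of_ne (heS hae) hav
      have hrec := ih (S.erase a) (Finset.erase_ssubset haS) (Finset.notMem_erase a S)
        (by
          rw [Finset.insert_erase haS]
          exact fun x hx => hdeg x (Finset.mem_insert_of_mem hx))
      rw [Finset.insert_erase haS] at hrec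
      refine le_trans (le_trans (Nat.mul_le_mul_left _ (Finset.card_le_card ?_))
        (card_sq_mul_card_filter_le E hv hav.symm hbv hab.symm)) hrec
      exact Finset.monotone_filter_right _ fun c _ hc => ⟨hc v hve b hbe, hc a hae b hbe⟩
    have hsum : k ^ 2 * ∑ e ∈ E.filter (fun e => v ∈ e ∧ e ⊆ insert v S),
        ((properColorings κ E S).filter fun c => ∀ u ∈ e, ∀ w ∈ e, c u = c w).card ≤
        (E.filter (v ∈ ·)).card * (2 * N) := by
      rw [Finset.mul_sum]
      refine (Finset.sum_le_card_nsmul _ _ _ hterm).trans ?_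
      rw [smul_eq_mul]
      exact Nat.mul_le_mul_right _
        (Finset.card_le_card (Finset.monotone_filter_right _ fun e _ he => he.1))
    have hle := card_properColorings_le_add_sum (κ := κ) E S v
    have hd := hdeg v (Finset.mem_insert_self v S)
    have hkpos : 0 < k ^ 2 := pow_pos Fintype.card_pos 2
    refine Nat.le_of_mul_le_mul_left ?_ hkpos
    nlinarith [Nat.mul_le_mul_left (k ^ 2) hle, Nat.mul_le_mul_right N hd]

theorem properColorings_nonempty [Nonempty κ] {E : Finset (Finset α)}
    (hE : ∀ e ∈ E, e.card = 3) (S : Finset α)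
    (hdeg : ∀ x ∈ S, 4 * (E.filter (x ∈ ·)).card ≤ Fintype.card κ ^ 2) :
    (properColorings κ E S).Nonempty := by
  induction S using Finset.induction_on with
  | empty =>
    refine ⟨fun _ => Classical.arbitrary κ, mem_properColorings.2 fun e he hes => ?_⟩
    have := hE e he
    simp [Finset.subset_empty.1 hes] at this
  | insert v S hv ih =>
    have hpos := (ih fun x hx => hdeg x (Finset.mem_insert_of_mem hx)).card_pos
    have := card_properColorings_le_two_mul_insert hE S hv hdeg
    exact Finset.card_pos.1 (by omega)

end ProperColorings

/-- For `r ≥ 1` and any 3-graph `G`, the subgraph induced on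
`V_small = {v : deg v ≤ r²/(12e)}` admits a proper coloring with `⌈r/2⌉` colors
(`⌈r/2⌉ = (r+1)/2` with natural division). -/
theorem colorableOn_Vsmall
    (r : ℕ) (hr : 1 ≤ r) (G : ThreeGraph) :
    G.ColorableOn {v : Fin G.n | (G.degree v : ℝ) ≤ (r : ℝ) ^ 2 / (12 * Real.exp 1)}
      ((r + 1) / 2) := by
  classical
  have : Nonempty (Fin ((r + 1) / 2)) := ⟨⟨0, by omega⟩⟩
  set S := Finset.univ.filter fun v : Fin G.n =>
    (G.degree v : ℝ) ≤ (r : ℝ) ^ 2 / (12 * Real.exp 1)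
  have hdeg : ∀ x ∈ S, 4 * (G.edges.filter (x ∈ ·)).card ≤
      Fintype.card (Fin ((r + 1) / 2)) ^ 2 := by
    intro x hx
    have hx' : (G.degree x : ℝ) ≤ (r : ℝ) ^ 2 / (12 * Real.exp 1) := (Finset.mem_filter.1 hx).2
    rw [le_div_iff₀ (by positivity)] at hx'
    have hdx : (0 : ℝ) ≤ G.degree x := Nat.cast_nonneg _
    have he := Real.exp_one_gt_d9
    have h16 : (16 * G.degree x : ℝ) ≤ (r : ℝ) ^ 2 := by nlinarith
    have h16' : 16 * G.degree x ≤ r ^ 2 := by exact_mod_cast h16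
    have hr2 : r ≤ 2 * ((r + 1) / 2) := by omega
    rw [Fintype.card_fin]
    change 4 * G.degree x ≤ _
    nlinarith [Nat.pow_le_pow_left hr2 2]
  obtain ⟨c, hc⟩ := properColorings_nonempty G.card_eq S hdeg
  refine ⟨c, fun e he heS => mem_properColorings.1 hc e he fun x hx => ?_⟩
  exact Finset.mem_filter.2 ⟨Finset.mem_univ x, heS hx⟩
end
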